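/- arXiv:2512.06317 — 2 statements merged into one kernel-verified Lean document; each statement's English description precedes it below -/
import Mathlib

section
/- Let 1 ≤ p < ∞, let X be a real normed linear space and Y a real Banach space, and let f ∈ Lip₀(X,Y). Then f ∈ 𝒦_p^{Ld}(X,Y) if and only if there exist a real Banach space Z, a Lipschitz compact map R ∈ Lip₀𝒦(X,Z), and a p-summing operator U ∈ Π_p(Z,Y) such that f = U ∘ R. -/
open scoped NNReal ZeroAtInfty
open Metric Set

/-- A Lipschitz map vanishing at `0` (an element of `Lip₀(X, Y)`). -/
def IsLip0 {X Y : Type*} [NormedAddCommGroup X] [NormedAddCommGroup Y] (f : X → Y) : Prop :=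
  f 0 = 0 ∧ ∃ K : ℝ≥0, LipschitzWith K f

/-- `a` belongs to the closed unit ball of `ℓ_{p'}`, where `p'` is the conjugate exponent of
`p` (`p' = ∞` when `p = 1`, `p' = p / (p - 1)` when `p > 1`). -/
def InBallConj (p : ℝ) (a : ℕ → ℝ) : Prop :=
  (p = 1 ∧ ∀ n, |a n| ≤ 1) ∨
    (p ≠ 1 ∧ Summable (fun n => |a n| ^ (p / (p - 1))) ∧ (∑' n, |a n| ^ (p / (p - 1))) ≤ 1)

/-- `K` is relatively `p`-compact: `K` is contained in the `p`-convex hull of a strongly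
`p`-summable sequence. -/
def RelPCompact (p : ℝ) {Z : Type*} [NormedAddCommGroup Z] [NormedSpace ℝ Z]
    (K : Set Z) : Prop :=
  ∃ z : ℕ → Z, Summable (fun n => ‖z n‖ ^ p) ∧
    ∀ w ∈ K, ∃ a : ℕ → ℝ, InBallConj p a ∧ HasSum (fun n => a n • z n) w

/-- A `p`-compact bounded linear operator: it maps the closed unit ball to a relatively
`p`-compact set. -/
def PCompactOp (p : ℝ) {Z W : Type*} [NormedAddCommGroup Z] [NormedSpace ℝ Z]
    [NormedAddCommGroup W] [NormedSpace ℝ W] (T : Z →L[ℝ] W) : Prop :=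
  RelPCompact p (T '' Metric.closedBall (0 : Z) 1)

/-- `e` realizes `Xs` as the Lipschitz dual `X^# = Lip₀(X, ℝ)`: `e` is a linear bijection of
`Xs` onto the space of real-valued Lipschitz functions on `X` vanishing at `0`, and the norm on
`Xs` is the Lipschitz constant. -/
structure IsLipDual {X Xs : Type*} [NormedAddCommGroup X] [NormedAddCommGroup Xs]
    [NormedSpace ℝ Xs] (e : Xs →ₗ[ℝ] (X → ℝ)) : Prop where
  inj : Function.Injective e
  surj : ∀ g : X → ℝ, g 0 = 0 → (∃ K : ℝ≥0, LipschitzWith K g) → ∃ h : Xs, e h = g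
  map_zero_pt : ∀ h : Xs, e h 0 = 0
  lip_norm : ∀ h : Xs, LipschitzWith ‖h‖₊ (e h)
  norm_le : ∀ (h : Xs) (K : ℝ≥0), LipschitzWith K (e h) → ‖h‖ ≤ (K : ℝ)

/-- The set of normalized increments `(f x₁ - f x₂) / ‖x₁ - x₂‖` of `f`. -/
def lipImage {X Y : Type*} [NormedAddCommGroup X] [NormedAddCommGroup Y] [NormedSpace ℝ Y]
    (f : X → Y) : Set Y :=
  { z | ∃ x₁ x₂ : X, x₁ ≠ x₂ ∧ z = ‖x₁ - x₂‖⁻¹ • (f x₁ - f x₂) }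

/-- A Lipschitz compact operator: a Lipschitz map vanishing at `0` whose set of normalized
increments is relatively compact. -/
def IsLipCompact {X Y : Type*} [NormedAddCommGroup X] [NormedAddCommGroup Y] [NormedSpace ℝ Y]
    (f : X → Y) : Prop :=
  IsLip0 f ∧ IsCompact (closure (lipImage f))

/-- A `p`-summing bounded linear operator (the defining inequality, raised to the `p`-th
power). -/
def PSumming (p : ℝ) {Z Y : Type*} [NormedAddCommGroup Z] [NormedSpace ℝ Z]
    [NormedAddCommGroup Y] [NormedSpace ℝ Y] (U : Z →L[ℝ] Y) : Prop :=
  ∃ C : ℝ, 0 ≤ C ∧ ∀ (n : ℕ) (z : Fin n → Z),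
    (∑ i, ‖U (z i)‖ ^ p) ≤
      C ^ p * ⨆ φ : { φ : Z →L[ℝ] ℝ // ‖φ‖ ≤ 1 }, ∑ i, |φ.1 (z i)| ^ p

universe u v w

/-- Hölder's inequality for a sequence in the closed unit ball of the dual of `ℓ_p`. -/
theorem InBallConj.holder {p : ℝ} (hp : 1 ≤ p) {a : ℕ → ℝ} (ha : InBallConj p a) {t : ℕ → ℝ}
    (ht : Summable fun n => |t n| ^ p) :
    Summable (fun n => |a n| * |t n|) ∧ ∑' n, |a n| * |t n| ≤ (∑' n, |t n| ^ p) ^ (1 / p) := by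
  rcases ha with ⟨rfl, ha⟩ | ⟨hp1, has, ha⟩
  · simp only [Real.rpow_one] at ht
    have hle : ∀ n, |a n| * |t n| ≤ |t n| := fun n =>
      mul_le_of_le_one_left (abs_nonneg _) (ha n)
    have hs : Summable (fun n => |a n| * |t n|) :=
      Summable.of_nonneg_of_le (fun n => by positivity) hle ht
    refine ⟨hs, ?_⟩
    simpa using hs.tsum_le_tsum hle ht
  · have hpq : p.HolderConjugate (p / (p - 1)) :=
      Real.HolderConjugate.conjExponent (lt_of_le_of_ne hp (Ne.symm hp1))
    obtain ⟨h1, h2⟩ := And.intro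
      (Real.summable_mul_of_Lp_Lq_of_nonneg hpq (fun n => abs_nonneg (t n))
        (fun n => abs_nonneg (a n)) ht has)
      (Real.inner_le_Lp_mul_Lq_tsum_of_nonneg hpq (fun n => abs_nonneg (t n))
        (fun n => abs_nonneg (a n)) ht has)
    simp only [mul_comm |t _|] at h1 h2
    refine ⟨h1, h2.trans (mul_le_of_le_one_right ?_ ?_)⟩
    · exact Real.rpow_nonneg (tsum_nonneg fun n => by positivity) _
    · exact Real.rpow_le_one (tsum_nonneg fun n => by positivity) ha
        (by have := hpq.symm.pos; positivity)

/-- The coefficients of a contractive functional on `ℓ_p` lie in the closed unit ball of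
the dual of `ℓ_p`. -/
theorem inBallConj_of_norm_le_one {p : ℝ} (hp : 1 ≤ p) [Fact (1 ≤ ENNReal.ofReal p)]
    (F : lp (fun _ : ℕ => ℝ) (ENNReal.ofReal p) →L[ℝ] ℝ) (hF : ‖F‖ ≤ 1) :
    InBallConj p (fun n => F (lp.single (ENNReal.ofReal p) n 1)) := by
  have hp0 : 0 < p := by linarith
  have hpt : (ENNReal.ofReal p).toReal = p := ENNReal.toReal_ofReal hp0.le
  have hle : ∀ v, |F v| ≤ ‖v‖ := fun v =>
    (F.le_opNorm v).trans (mul_le_of_le_one_left (norm_nonneg _) hF)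
  by_cases hp1 : p = 1
  · refine Or.inl ⟨hp1, fun n => (hle _).trans ?_⟩
    rw [lp.norm_single (by simpa using hp0)]
    simp
  · refine Or.inr ⟨hp1, ?_⟩
    set a : ℕ → ℝ := fun n => F (lp.single (ENNReal.ofReal p) n 1) with ha
    have hpq : p.HolderConjugate (p / (p - 1)) :=
      Real.HolderConjugate.conjExponent (lt_of_le_of_ne hp (Ne.symm hp1))
    set q := p / (p - 1) with hq
    have hq0 : 0 < q := hpq.symm.pos
    have hsum : ∀ s : Finset ℕ, ∑ n ∈ s, |a n| ^ q ≤ 1 := by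
      intro s
      set S := ∑ n ∈ s, |a n| ^ q with hS
      have hS0 : 0 ≤ S := Finset.sum_nonneg fun n _ => by positivity
      set b : ℕ → ℝ := fun n => SignType.sign (a n) * |a n| ^ (q - 1) with hb
      have hba : ∀ n, b n * a n = |a n| ^ q := by
        intro n
        rcases eq_or_ne (a n) 0 with h | h
        · simp [h, Real.zero_rpow hq0.ne']
        · have h' : 0 < |a n| := abs_pos.2 h
          have : SignType.sign (a n) * a n = |a n| := by simp
          rw [hb]
          calc _ = |a n| ^ (q - 1) * (SignType.sign (a n) * a n) := by ring
            _ = |a n| ^ q := by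
              rw [this, Real.rpow_sub_one h'.ne']; field_simp
      have hbp : ∀ n, ‖b n‖ ^ p ≤ |a n| ^ q := by
        intro n
        rcases eq_or_ne (a n) 0 with h | h
        · simp [hb, h, Real.zero_rpow hp0.ne', Real.zero_rpow hq0.ne']
        · have h' : 0 < |a n| := abs_pos.2 h
          have hs : ‖b n‖ ≤ |a n| ^ (q - 1) := by
            rw [hb, Real.norm_eq_abs, abs_mul, abs_of_nonneg (a := |a n| ^ (q - 1)) (by positivity)]
            refine mul_le_of_le_one_left (by positivity) ?_
            rcases SignType.sign (a n) <;> simp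
          refine (Real.rpow_le_rpow (norm_nonneg _) hs hp0.le).trans ?_
          rw [← Real.rpow_mul h'.le]
          apply le_of_eq
          congr 1
          have : p - 1 ≠ 0 := sub_ne_zero.2 hp1
          rw [hq]; field_simp; ring
      set v := ∑ n ∈ s, lp.single (E := fun _ : ℕ => ℝ) (ENNReal.ofReal p) n (b n) with hv
      have hFv : F v = S := by
        rw [hv, map_sum, hS]
        refine Finset.sum_congr rfl fun n _ => ?_
        have : lp.single (E := fun _ : ℕ => ℝ) (ENNReal.ofReal p) n (b n) =
            b n • lp.single (E := fun _ : ℕ => ℝ) (ENNReal.ofReal p) n 1 := by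
          rw [← lp.single_smul]; simp
        rw [this, map_smul, smul_eq_mul]
        exact hba n
      have hnv : ‖v‖ ^ p ≤ S := by
        have := lp.norm_sum_single (E := fun _ : ℕ => ℝ) (p := ENNReal.ofReal p)
          (by rw [hpt]; exact hp0) b s
        rw [hpt] at this
        rw [hv, this]
        exact Finset.sum_le_sum fun n _ => hbp n
      have h1 : S ^ p ≤ S := by
        refine le_trans ?_ hnv
        refine Real.rpow_le_rpow hS0 ?_ hp0.le
        rw [← hFv]; exact (le_abs_self _).trans (hle v)
      by_contra! h
      have : S ^ (1 : ℝ) < S ^ p :=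
        Real.rpow_lt_rpow_of_exponent_lt h (lt_of_le_of_ne hp (Ne.symm hp1))
      rw [Real.rpow_one] at this
      linarith
    exact ⟨summable_of_sum_le (fun n => by positivity) hsum,
      Real.tsum_le_of_sum_le (fun n => by positivity) hsum⟩

/-- If `m v h` is dominated by the `ℓ_p`-norm of `(m v (g n))ₙ` for all `v` in a separating family
of functionals, then `h` lies in the `p`-convex hull of `(g n)`. -/
theorem exists_hasSum_of_rpow_le_tsum {p : ℝ} (hp : 1 ≤ p) {V E : Type*} [AddCommGroup V]
    [Module ℝ V] [NormedAddCommGroup E] [NormedSpace ℝ E] [CompleteSpace E]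
    (m : V →ₗ[ℝ] E →L[ℝ] ℝ) (hm : ∀ h, (∀ v, m v h = 0) → h = 0) {g : ℕ → E}
    (hg : Summable fun n => ‖g n‖ ^ p) {h : E}
    (hh : ∀ v, |m v h| ^ p ≤ ∑' n, |m v (g n)| ^ p) :
    ∃ a, InBallConj p a ∧ HasSum (fun n => a n • g n) h := by
  have hp0 : 0 < p := by linarith
  have hpt : (ENNReal.ofReal p).toReal = p := ENNReal.toReal_ofReal hp0.le
  have : Fact (1 ≤ ENNReal.ofReal p) := ⟨by simpa using ENNReal.ofReal_le_ofReal hp⟩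
  have hmem : ∀ v, Memℓp (fun n => m v (g n)) (ENNReal.ofReal p) := by
    intro v
    apply memℓp_gen
    rw [hpt]
    refine Summable.of_nonneg_of_le (fun n => by positivity) (fun n => ?_)
      (hg.mul_left (‖m v‖ ^ p))
    rw [← Real.mul_rpow (norm_nonneg _) (norm_nonneg _)]
    exact Real.rpow_le_rpow (norm_nonneg _) ((m v).le_opNorm _) hp0.le
  let G : V →ₗ[ℝ] lp (fun _ : ℕ => ℝ) (ENNReal.ofReal p) :=
    { toFun := fun v => ⟨fun n => m v (g n), hmem v⟩
      map_add' := fun v w => by ext n; simp; rfl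
      map_smul' := fun c v => by ext n; simp }
  let L : V →ₗ[ℝ] ℝ :=
    { toFun := fun v => m v h
      map_add' := fun v w => by simp
      map_smul' := fun c v => by simp }
  have hbound : ∀ v, ‖L v‖ ≤ 1 * ‖G v‖ := by
    intro v
    rw [one_mul, ← Real.rpow_le_rpow_iff (norm_nonneg _) (norm_nonneg _) hp0]
    have := lp.norm_rpow_eq_tsum (p := ENNReal.ofReal p) (by rw [hpt]; exact hp0) (G v)
    rw [hpt] at this
    rw [this]
    exact hh v
  let T := L.compLeftInverse G
  have hT : ∀ v, T ⟨G v, v, rfl⟩ = L v := fun v =>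
    LinearMap.compLeftInverse_apply_of_bdd L G ⟨1, hbound⟩ v _ rfl
  have hTn : ‖T‖ ≤ 1 := by
    refine T.opNorm_le_bound zero_le_one ?_
    rintro ⟨_, v, rfl⟩
    rw [hT]
    exact hbound v
  obtain ⟨F, hF, hFn⟩ := exists_extension_norm_eq (LinearMap.range G) T
  have hFG : ∀ v, F (G v) = m v h := fun v => (hF ⟨G v, v, rfl⟩).trans (hT v)
  set a : ℕ → ℝ := fun n => F (lp.single (ENNReal.ofReal p) n 1) with ha
  have hab : InBallConj p a := inBallConj_of_norm_le_one hp F (hFn.trans_le hTn)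
  have hFs : ∀ w : lp (fun _ : ℕ => ℝ) (ENNReal.ofReal p), HasSum (fun n => a n * w n) (F w) := by
    intro w
    have hw : (fun n => a n * w n) =
        fun n => F (lp.single (E := fun _ : ℕ => ℝ) (ENNReal.ofReal p) n (w n)) := by
      funext n
      have : lp.single (E := fun _ : ℕ => ℝ) (ENNReal.ofReal p) n (w n) =
          w n • lp.single (E := fun _ : ℕ => ℝ) (ENNReal.ofReal p) n 1 := by
        rw [← lp.single_smul]; simp
      rw [this, map_smul, smul_eq_mul, mul_comm]
    rw [hw]
    exact (lp.hasSum_single ENNReal.ofReal_ne_top w).mapL F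
  have hsum : Summable fun n => a n • g n := by
    refine Summable.of_norm ?_
    have := (hab.holder hp (t := fun n => ‖g n‖) (by simpa using hg)).1
    simpa [norm_smul] using this
  refine ⟨a, hab, ?_⟩
  have : (∑' n, a n • g n) - h = 0 := by
    refine hm _ fun v => ?_
    have h1 := hsum.hasSum.mapL (m v)
    have h2 := hFs (G v)
    rw [hFG] at h2
    simp only [map_smul, smul_eq_mul] at h1
    rw [map_sub, h1.unique h2, sub_self]
  rw [← sub_eq_zero.1 this]
  exact hsum.hasSum

theorem totallyBounded_range_of_coordinates {B α : Type*} [PseudoMetricSpace α] {Φ : B → α}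
    (H : ∀ ε > 0, ∃ (n : ℕ) (F : B → Fin n → ℝ), Bornology.IsBounded (range F) ∧
      ∃ δ > 0, ∀ b b', dist (F b) (F b') < δ → dist (Φ b) (Φ b') < ε) :
    TotallyBounded (range Φ) := by
  rw [Metric.totallyBounded_iff]
  intro ε hε
  obtain ⟨n, F, hF, δ, hδ, h⟩ := H ε hε
  have hFt : TotallyBounded (range F) :=
    hF.isCompact_closure.totallyBounded.subset subset_closure
  obtain ⟨t, ht, htf, hcov⟩ := Metric.finite_approx_of_totallyBounded hFt δ hδ
  choose σ hσ using ht
  have := htf.to_subtype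
  refine ⟨range fun v : t => Φ (σ v.2), Set.finite_range _, ?_⟩
  rintro _ ⟨b, rfl⟩
  obtain ⟨v, hv, hbv⟩ := mem_iUnion₂.1 (hcov ⟨b, rfl⟩)
  refine mem_iUnion₂.2 ⟨_, ⟨⟨v, hv⟩, rfl⟩, h _ _ ?_⟩
  rw [hσ hv]
  exact hbv

theorem Set.Finite.exists_nat_coding {B E : Type*} [Zero E] {D : B → E} (hD : (range D).Finite) :
    ∃ (N : ℕ) (c : B → ℕ) (y : ℕ → E), (∀ b, c b < N) ∧ (∀ b, y (c b) = D b) ∧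
      ∀ j, y j = 0 ∨ y j ∈ range D := by
  have := hD.to_subtype
  obtain ⟨N, ⟨η⟩⟩ := Finite.exists_equiv_fin (range D)
  refine ⟨N, fun b => η ⟨D b, b, rfl⟩, fun j => if h : j < N then (η.symm ⟨j, h⟩ : E) else 0,
    fun b => (η _).2, fun b => by simp, fun j => ?_⟩
  by_cases h : j < N
  · right
    simp only [h, dite_true]
    exact (η.symm ⟨j, h⟩).2
  · left; simp [h]

/-- A totally bounded family is a rapidly convergent series of finitely valued functions. -/
theorem TotallyBounded.exists_hasSum_finitely_valued {B E : Type*} [NormedAddCommGroup E]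
    [CompleteSpace E] {Φ : B → E} (h : TotallyBounded (range Φ)) :
    ∃ (L : ℝ) (N : ℕ → ℕ) (c : ℕ → B → ℕ) (y : ℕ → ℕ → E), 0 ≤ L ∧ (∀ k b, c k b < N k) ∧
      (∀ k j, ‖y k j‖ ≤ L * (1 / 4) ^ k) ∧ ∀ b, HasSum (fun k => y k (c k b)) (Φ b) := by
  obtain ⟨M, hM⟩ := h.isBounded.exists_norm_le
  have hM' : ∀ b, ‖Φ b‖ ≤ |M| + 1 := fun b =>
    (hM _ ⟨b, rfl⟩).trans ((le_abs_self M).trans (by linarith))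
  set K := |M| + 1 with hK
  have hK0 : 0 < K := by positivity
  have hP : ∀ k : ℕ, ∃ P : B → E, (range P).Finite ∧ (∀ b, ‖Φ b - P b‖ ≤ K * (1 / 4) ^ k) ∧
      (k = 0 → P = 0) := by
    intro k
    rcases Nat.eq_zero_or_pos k with rfl | hk
    · exact ⟨0, (Set.finite_singleton (0 : E)).subset (by rintro _ ⟨b, rfl⟩; rfl),
        by simpa using hM', fun _ => rfl⟩
    · obtain ⟨t, htf, ht⟩ := Metric.totallyBounded_iff.1 h (K * (1 / 4) ^ k) (by positivity)
      have : ∀ b, ∃ v ∈ t, dist (Φ b) v < K * (1 / 4) ^ k := fun b => by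
        simpa using ht ⟨b, rfl⟩
      choose P hPt hPd using this
      refine ⟨P, htf.subset (range_subset_iff.2 hPt), fun b => ?_, fun h0 => absurd h0 hk.ne'⟩
      rw [← dist_eq_norm]; exact (hPd b).le
  choose P hPf hPd hP0 using hP
  have hDf : ∀ k, (range fun b => P (k + 1) b - P k b).Finite := fun k => by
    refine ((hPf (k + 1)).image2 (fun u v => u - v) (hPf k)).subset ?_
    rintro _ ⟨b, rfl⟩
    exact ⟨_, ⟨b, rfl⟩, _, ⟨b, rfl⟩, rfl⟩
  have hDn : ∀ k b, ‖P (k + 1) b - P k b‖ ≤ 2 * K * (1 / 4) ^ k := fun k b => by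
    have h1 := hPd k b
    have h2 := hPd (k + 1) b
    have h3 : ‖P (k + 1) b - P k b‖ ≤ ‖Φ b - P k b‖ + ‖Φ b - P (k + 1) b‖ := by
      have := norm_sub_le (Φ b - P k b) (Φ b - P (k + 1) b)
      simpa using this
    have h4 : (0 : ℝ) < (1 / 4) ^ k := by positivity
    rw [pow_succ] at h2
    nlinarith
  choose N c y hc hyc hy using fun k => (hDf k).exists_nat_coding
  have hyn : ∀ k j, ‖y k j‖ ≤ 2 * K * (1 / 4) ^ k := fun k j => by
    rcases hy k j with h0 | ⟨b, hb⟩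
    · rw [h0, norm_zero]; positivity
    · rw [← hb]; exact hDn k b
  refine ⟨2 * K, N, c, y, by positivity, hc, hyn, fun b => ?_⟩
  have hs : Summable fun k => y k (c k b) := by
    refine Summable.of_norm_bounded (g := fun k => 2 * K * (1 / 4 : ℝ) ^ k) ?_ fun k => hyn k _
    exact (summable_geometric_of_lt_one (by norm_num) (by norm_num)).mul_left _
  rw [hs.hasSum_iff_tendsto_nat]
  have hsum : ∀ n, ∑ k ∈ Finset.range n, y k (c k b) = P n b := fun n => by
    simp only [hyc]
    rw [Finset.sum_range_sub (fun k => P k b), hP0 0 rfl]; simp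
  simp only [hsum]
  rw [tendsto_iff_norm_sub_tendsto_zero]
  refine squeeze_zero (fun _ => norm_nonneg _) (fun k => ?_)
    (g := fun k => K * (1 / 4) ^ k) (by simpa using (tendsto_pow_atTop_nhds_zero_of_lt_one
      (r := (1 / 4 : ℝ)) (by norm_num) (by norm_num)).const_mul K)
  rw [norm_sub_rev]; exact hPd k b

/-- A bound for the `p`-th power of a series by a weighted series of `p`-th powers. -/
theorem abs_rpow_le_tsum_of_hasSum {p : ℝ} (hp : 0 < p) {t : ℕ → ℝ} {s : ℝ} (ht : HasSum t s)
    (hs : Summable fun k => (2 ^ (k + 1) * |t k|) ^ p) :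
    |s| ^ p ≤ ∑' k, (2 ^ (k + 1) * |t k|) ^ p := by
  set M := ∑' k, (2 ^ (k + 1) * |t k|) ^ p with hM
  have hM0 : 0 ≤ M := tsum_nonneg fun k => by positivity
  have hk : ∀ k, ‖t k‖ ≤ M ^ p⁻¹ / 2 / 2 ^ k := fun k => by
    have h1 : (2 ^ (k + 1) * |t k|) ^ p ≤ M :=
      hs.le_tsum k fun j _ => by positivity
    have h2 : 2 ^ (k + 1) * |t k| ≤ M ^ p⁻¹ :=
      (Real.le_rpow_inv_iff_of_pos (by positivity) hM0 hp).2 h1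
    rw [Real.norm_eq_abs, div_div, ← pow_succ', le_div_iff₀ (by positivity)]
    linarith
  have h1 : |s| ≤ M ^ p⁻¹ := by
    have := tsum_of_norm_bounded (hasSum_geometric_two' (M ^ p⁻¹)) hk
    rwa [ht.tsum_eq] at this
  exact (Real.le_rpow_inv_iff_of_pos (abs_nonneg _) hM0 hp).1 h1

/-- The space of bounded real functions on a set. -/
def boundedFunctions (B : Type*) : Submodule ℝ (B → ℝ) where
  carrier := { g | ∃ M, ∀ b, |g b| ≤ M }
  add_mem' := by
    rintro f g ⟨M, hM⟩ ⟨M', hM'⟩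
    exact ⟨M + M', fun b => (abs_add_le _ _).trans (add_le_add (hM b) (hM' b))⟩
  zero_mem' := ⟨0, by simp⟩
  smul_mem' := by
    rintro c g ⟨M, hM⟩
    refine ⟨|c| * M, fun b => ?_⟩
    simp only [Pi.smul_apply, smul_eq_mul, abs_mul]
    exact mul_le_mul_of_nonneg_left (hM b) (abs_nonneg c)

/-- Pietsch domination by a positive normalized functional on the bounded functions on the dual
ball. -/
theorem PSumming.exists_domination {p : ℝ} (hp : 0 < p) {Z Y : Type*} [NormedAddCommGroup Z]
    [NormedSpace ℝ Z] [NormedAddCommGroup Y] [NormedSpace ℝ Y] {U : Z →L[ℝ] Y}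
    (hU : PSumming p U) :
    ∃ C : ℝ, 0 ≤ C ∧ ∃ Λ : boundedFunctions { φ : Z →L[ℝ] ℝ // ‖φ‖ ≤ 1 } →ₗ[ℝ] ℝ,
      (∀ g, (∀ φ, 0 ≤ g.1 φ) → 0 ≤ Λ g) ∧ (∀ g, (∀ φ, g.1 φ = 1) → Λ g = 1) ∧
      ∀ z g, (∀ φ, g.1 φ = |φ.1 z| ^ p) → ‖U z‖ ^ p ≤ C ^ p * Λ g := by
  obtain ⟨C, hC, hU⟩ := hU
  refine ⟨C, hC, ?_⟩
  set B := { φ : Z →L[ℝ] ℝ // ‖φ‖ ≤ 1 } with hB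
  have hne : Nonempty B := ⟨⟨0, by simp⟩⟩
  let s : PointedCone ℝ (boundedFunctions B) :=
    { carrier := { g | ∃ (n : ℕ) (z : Fin n → Z), ∀ φ : B,
        C ^ p * ∑ i, |φ.1 (z i)| ^ p - ∑ i, ‖U (z i)‖ ^ p ≤ g.1 φ }
      add_mem' := by
        rintro f g ⟨n, z, hz⟩ ⟨n', z', hz'⟩
        refine ⟨n + n', Fin.append z z', fun φ => ?_⟩
        simp only [Fin.sum_univ_add, Fin.append_left, Fin.append_right]
        have := add_le_add (hz φ) (hz' φ)
        calc _ = _ := by ring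
          _ ≤ _ := this
      zero_mem' := ⟨0, Fin.elim0, fun φ => by simp⟩
      smul_mem' := by
        rintro ⟨c, hc⟩ g ⟨n, z, hz⟩
        refine ⟨n, fun i => c ^ p⁻¹ • z i, fun φ => ?_⟩
        have hcp : (c ^ p⁻¹) ^ p = c := Real.rpow_inv_rpow hc hp.ne'
        have h0 : 0 ≤ c ^ p⁻¹ := Real.rpow_nonneg hc _
        have h1 : ∀ i, |φ.1 (c ^ p⁻¹ • z i)| ^ p = c * |φ.1 (z i)| ^ p := fun i => by
          rw [map_smul, smul_eq_mul, abs_mul, abs_of_nonneg h0,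
            Real.mul_rpow h0 (abs_nonneg _), hcp]
        have h2 : ∀ i, ‖U (c ^ p⁻¹ • z i)‖ ^ p = c * ‖U (z i)‖ ^ p := fun i => by
          rw [map_smul, norm_smul, Real.norm_of_nonneg h0,
            Real.mul_rpow h0 (norm_nonneg _), hcp]
        simp only [h1, h2, ← Finset.mul_sum]
        have := mul_le_mul_of_nonneg_left (hz φ) hc
        calc _ = _ := by ring
          _ ≤ _ := this }
  let one : boundedFunctions B := ⟨fun _ => 1, 1, fun _ => by simp⟩
  have hone : one ≠ 0 := fun h => by
    have := congrFun (congrArg Subtype.val h) hne.some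
    simp [one] at this
  have hspos : ∀ g : boundedFunctions B, (∀ φ, 0 ≤ g.1 φ) → g ∈ s := fun g hg =>
    ⟨0, Fin.elim0, fun φ => by simpa using hg φ⟩
  let f : boundedFunctions B →ₗ.[ℝ] ℝ := LinearPMap.mkSpanSingleton (σ := RingHom.id ℝ) one 1 hone
  have hfd : ∀ r : ℝ, r • one ∈ f.domain := fun r =>
    Submodule.smul_mem _ _ (Submodule.mem_span_singleton_self _)
  have hf : ∀ r : ℝ, f ⟨r • one, hfd r⟩ = r := fun r => by
    refine (LinearPMap.mkSpanSingleton'_apply (σ := RingHom.id ℝ) one (1 : ℝ) _ r _).trans ?_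
    simp
  obtain ⟨Λ, hΛf, hΛs⟩ := riesz_extension s f (by
    rintro ⟨x, hx⟩ hxs
    obtain ⟨r, rfl⟩ := Submodule.mem_span_singleton.1 hx
    rw [hf r]
    obtain ⟨n, z, hz⟩ := hxs
    have h1 := hU n z
    have h2 : C ^ p * ⨆ φ : B, ∑ i, |φ.1 (z i)| ^ p ≤ r + ∑ i, ‖U (z i)‖ ^ p := by
      rw [Real.mul_iSup_of_nonneg (by positivity)]
      refine ciSup_le fun φ => ?_
      have := hz φ
      simp only [one, Submodule.coe_smul, Pi.smul_apply, smul_eq_mul, mul_one] at this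
      linarith
    linarith) (by
    rintro ⟨g, M, hM⟩
    refine ⟨⟨M • one, hfd M⟩, hspos _ fun φ => ?_⟩
    have := neg_abs_le (g φ)
    have := hM φ
    simp only [one, Submodule.coe_add, Submodule.coe_smul, Pi.add_apply, Pi.smul_apply,
      smul_eq_mul, mul_one]
    linarith)
  have hΛ1 : Λ one = 1 := by
    have := hΛf ⟨(1 : ℝ) • one, hfd 1⟩
    rw [hf] at this
    simpa using this
  refine ⟨Λ, fun g hg => hΛs _ (hspos g hg), fun g hg => ?_, fun z g hg => ?_⟩
  · have : g = one := Subtype.ext (funext hg)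
    rw [this, hΛ1]
  · have : 0 ≤ Λ (C ^ p • g - ‖U z‖ ^ p • one) := by
      refine hΛs _ ⟨1, fun _ => z, fun φ => ?_⟩
      simp [one, hg]
    rw [map_sub, map_smul, map_smul, hΛ1, smul_eq_mul, smul_eq_mul] at this
    linarith
set_option maxHeartbeats 1000000 in
/-- A positive normalized functional on bounded functions, applied to `|m ∘ Φ| ^ p` with `Φ` a
totally bounded family, is dominated by `(∑ |m (g n)| ^ p)` for a strongly `p`-summable
sequence `g` not depending on `m`. -/
theorem TotallyBounded.exists_summable_domination {p : ℝ} (hp : 0 < p) {B E : Type*}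
    [NormedAddCommGroup E] [NormedSpace ℝ E] [CompleteSpace E] {Φ : B → E}
    (h : TotallyBounded (range Φ)) (Λ : boundedFunctions B →ₗ[ℝ] ℝ)
    (hΛ0 : ∀ g, (∀ b, 0 ≤ g.1 b) → 0 ≤ Λ g) (hΛ1 : ∀ g, (∀ b, g.1 b = 1) → Λ g = 1) :
    ∃ g : ℕ → E, Summable (fun n => ‖g n‖ ^ p) ∧
      ∀ (m : E →L[ℝ] ℝ) (u : boundedFunctions B), (∀ b, u.1 b = |m (Φ b)| ^ p) →
        Λ u ≤ ∑' n, |m (g n)| ^ p := by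
  classical
  obtain ⟨L, N, c, y, hL, hc, hy, hΦ⟩ := h.exists_hasSum_finitely_valued
  have hmono : ∀ f g : boundedFunctions B, (∀ b, f.1 b ≤ g.1 b) → Λ f ≤ Λ g := fun f g hfg => by
    have := hΛ0 (g - f) fun b => sub_nonneg.2 (hfg b)
    rwa [map_sub, sub_nonneg] at this
  let ind : ℕ → ℕ → boundedFunctions B := fun k j =>
    ⟨fun b => if c k b = j then 1 else 0, 1, fun b => by dsimp only; split_ifs <;> simp⟩
  set w : ℕ → ℕ → ℝ := fun k j => Λ (ind k j) with hw
  have hw0 : ∀ k j, 0 ≤ w k j := fun k j => hΛ0 _ fun b => by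
    simp only [ind]; split_ifs <;> simp
  have hwN : ∀ k j, j ∉ Finset.range (N k) → w k j = 0 := fun k j hj => by
    have : ind k j = 0 := Subtype.ext <| funext fun b => by
      have := hc k b
      rw [Finset.mem_range, not_lt] at hj
      simp only [ind, ZeroMemClass.coe_zero, Pi.zero_apply, ite_eq_right_iff]
      omega
    rw [hw]; simp [this]
  have hsum : ∀ (k : ℕ) (G : ℕ → ℝ) (u : boundedFunctions B), (∀ b, u.1 b = G (c k b)) →
      HasSum (fun j => w k j * G j) (Λ u) := fun k G u hu => by
    have hue : u = ∑ j ∈ Finset.range (N k), G j • ind k j := by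
      refine Subtype.ext <| funext fun b => ?_
      rw [hu, AddSubmonoidClass.coe_finsetSum, Finset.sum_apply]
      simp [ind, hc k b]
    have : Λ u = ∑ j ∈ Finset.range (N k), w k j * G j := by
      rw [hue, map_sum]
      exact Finset.sum_congr rfl fun j _ => by rw [map_smul, smul_eq_mul, mul_comm]
    rw [this]
    exact hasSum_sum_of_ne_finset_zero fun j hj => by rw [hwN k j hj, zero_mul]
  have hw1 : ∀ k, HasSum (w k) 1 := fun k => by
    have := hsum k (fun _ => 1) ⟨fun _ => 1, 1, fun _ => by simp⟩ fun _ => rfl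
    rw [hΛ1 _ fun _ => rfl] at this
    simpa using this
  set q : ℝ := (1 / 2) ^ p with hq
  have hq0 : 0 ≤ q := by positivity
  have hq1 : q < 1 := Real.rpow_lt_one (by norm_num) (by norm_num) hp
  have hgeom : ∀ A : ℝ, 0 ≤ A → Summable fun k : ℕ => (A * (1 / 2) ^ k) ^ p := fun A hA => by
    have : (fun k : ℕ => (A * (1 / 2) ^ k) ^ p) = fun k : ℕ => A ^ p * q ^ k := by
      funext k
      rw [Real.mul_rpow hA (by positivity), hq, ← Real.rpow_natCast, ← Real.rpow_natCast,
        ← Real.rpow_mul (by norm_num), ← Real.rpow_mul (by norm_num), mul_comm p]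
    rw [this]
    exact (summable_geometric_of_lt_one hq0 hq1).mul_left _
  have hscale : ∀ (k j : ℕ) (A : ℝ), 0 ≤ A → ∀ t, t ≤ A * ‖y k j‖ →
      2 ^ (k + 1) * t ≤ 2 * L * A * (1 / 2) ^ k := fun k j A hA t ht => by
    have h1 : t ≤ A * (L * (1 / 4) ^ k) := ht.trans (mul_le_mul_of_nonneg_left (hy k j) hA)
    have h2 : (2 : ℝ) ^ k * (1 / 4) ^ k = (1 / 2) ^ k := by rw [← mul_pow]; norm_num
    calc 2 ^ (k + 1) * t ≤ 2 ^ (k + 1) * (A * (L * (1 / 4) ^ k)) := by gcongr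
      _ = 2 * L * A * ((2 : ℝ) ^ k * (1 / 4) ^ k) := by ring
      _ = _ := by rw [h2]
  obtain ⟨κ, hκ⟩ : ∃ κ : ℕ → ℝ, ∀ k, κ k = (2 * L * 1 * (1 / 2) ^ k) ^ p := ⟨_, fun _ => rfl⟩
  have hκ0 : ∀ k, 0 ≤ κ k := fun k => by rw [hκ]; positivity
  have hκs : Summable κ := by
    rw [funext hκ]; exact hgeom (2 * L * 1) (by positivity)
  have hprod : Summable fun x : ℕ × ℕ => w x.1 x.2 * κ x.1 := by
    have h0 : ∀ x : ℕ × ℕ, 0 ≤ w x.1 x.2 * κ x.1 := fun x => mul_nonneg (hw0 _ _) (hκ0 _)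
    refine (summable_prod_of_nonneg h0).2 ⟨fun k => (hw1 k).summable.mul_right (κ k), ?_⟩
    have : ∀ k, ∑' j, w k j * κ k = κ k := fun k => by
      rw [tsum_mul_right, (hw1 k).tsum_eq, one_mul]
    simpa only [this] using hκs
  let g : ℕ × ℕ → E := fun x => (2 ^ (x.1 + 1) * w x.1 x.2 ^ p⁻¹) • y x.1 x.2
  have hpow : ∀ (k j : ℕ) (t : ℝ), 0 ≤ t →
      (2 ^ (k + 1) * w k j ^ p⁻¹ * t) ^ p = w k j * (2 ^ (k + 1) * t) ^ p := fun k j t ht => by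
    have h1 : 0 ≤ w k j ^ p⁻¹ := Real.rpow_nonneg (hw0 k j) _
    rw [show (2 : ℝ) ^ (k + 1) * w k j ^ p⁻¹ * t = w k j ^ p⁻¹ * (2 ^ (k + 1) * t) by ring,
      Real.mul_rpow h1 (by positivity), Real.rpow_inv_rpow (hw0 k j) hp.ne']
  have hgn : ∀ x, ‖g x‖ ^ p = w x.1 x.2 * (2 ^ (x.1 + 1) * ‖y x.1 x.2‖) ^ p := fun x => by
    have h1 : 0 ≤ w x.1 x.2 ^ p⁻¹ := Real.rpow_nonneg (hw0 _ _) _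
    rw [← hpow _ _ _ (norm_nonneg _), norm_smul, Real.norm_of_nonneg (by positivity)]
  have hgm : ∀ (m : E →L[ℝ] ℝ) x, |m (g x)| ^ p =
      w x.1 x.2 * (2 ^ (x.1 + 1) * |m (y x.1 x.2)|) ^ p := fun m x => by
    have h1 : 0 ≤ w x.1 x.2 ^ p⁻¹ := Real.rpow_nonneg (hw0 _ _) _
    rw [← hpow _ _ _ (abs_nonneg _), map_smul, smul_eq_mul, abs_mul,
      abs_of_nonneg (a := 2 ^ (x.1 + 1) * w x.1 x.2 ^ p⁻¹) (by positivity)]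
  have hgs : Summable fun x => ‖g x‖ ^ p := by
    refine Summable.of_nonneg_of_le (fun x => by positivity) (fun x => ?_) hprod
    rw [hgn, hκ]
    refine mul_le_mul_of_nonneg_left (Real.rpow_le_rpow (by positivity) ?_ hp.le) (hw0 _ _)
    exact hscale x.1 x.2 1 zero_le_one ‖y x.1 x.2‖ (by simp)
  have hgms : ∀ m : E →L[ℝ] ℝ, Summable fun x => |m (g x)| ^ p := fun m => by
    refine Summable.of_nonneg_of_le (fun x => by positivity) (fun x => ?_)
      (hgs.mul_left (‖m‖ ^ p))
    rw [← Real.mul_rpow (norm_nonneg _) (norm_nonneg _)]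
    exact Real.rpow_le_rpow (abs_nonneg _) (m.le_opNorm _) hp.le
  let η : ℕ ≃ ℕ × ℕ := Nat.pairEquiv.symm
  refine ⟨fun n => g (η n), η.summable_iff.2 hgs, fun m u hu => ?_⟩
  rw [η.tsum_eq fun x => |m (g x)| ^ p]
  set τ : ℕ → ℝ := fun k => (2 * L * ‖m‖ * (1 / 2) ^ k) ^ p with hτ
  have hτs : Summable τ := hgeom _ (by positivity)
  have hτy : ∀ k j, (2 ^ (k + 1) * |m (y k j)|) ^ p ≤ τ k := fun k j =>
    Real.rpow_le_rpow (by positivity) (hscale k j _ (norm_nonneg _) _ (m.le_opNorm _)) hp.le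
  let v : ℕ → boundedFunctions B := fun k =>
    ⟨fun b => (2 ^ (k + 1) * |m (y k (c k b))|) ^ p, τ k, fun b => by
      rw [abs_of_nonneg (by positivity)]; exact hτy _ _⟩
  have hfib : HasSum (fun k => Λ (v k)) (∑' x, |m (g x)| ^ p) := by
    refine (hgms m).hasSum.prod_fiberwise fun k => ?_
    simp only [hgm]
    exact hsum k (fun j => (2 ^ (k + 1) * |m (y k j)|) ^ p) (v k) fun _ => rfl
  have hvs : ∀ b, Summable fun k => (v k).1 b := fun b =>
    Summable.of_nonneg_of_le (fun k => by simp only [v]; positivity) (fun k => hτy k _) hτs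
  have hub : ∀ n, Λ u ≤ ∑' x, |m (g x)| ^ p + ∑' k, τ (k + n) := fun n => by
    let δ : boundedFunctions B := ⟨fun _ => 1, 1, fun _ => by simp⟩
    have h1 : Λ u ≤ Λ (∑ k ∈ Finset.range n, v k + (∑' k, τ (k + n)) • δ) := by
      refine hmono _ _ fun b => ?_
      have h2 : |m (Φ b)| ^ p ≤ ∑' k, (v k).1 b :=
        abs_rpow_le_tsum_of_hasSum hp ((hΦ b).mapL m) (hvs b)
      rw [hu]
      refine h2.trans ?_
      rw [← (hvs b).sum_add_tsum_nat_add n]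
      simp only [Submodule.coe_add, AddSubmonoidClass.coe_finsetSum, Pi.add_apply,
        Finset.sum_apply, Submodule.coe_smul, Pi.smul_apply, smul_eq_mul, δ, mul_one]
      exact add_le_add le_rfl (Summable.tsum_le_tsum (fun k => hτy _ _)
        ((summable_nat_add_iff n).2 (hvs b)) ((summable_nat_add_iff n).2 hτs))
    rw [map_add, map_sum, map_smul, hΛ1 δ fun _ => rfl, smul_eq_mul, mul_one] at h1
    refine h1.trans (add_le_add_left ?_ _)
    exact sum_le_hasSum _ (fun k _ => hΛ0 _ fun b => by simp only [v]; positivity) hfib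
  have hlim : Filter.Tendsto (fun n => ∑' x, |m (g x)| ^ p + ∑' k, τ (k + n)) Filter.atTop
      (nhds (∑' x, |m (g x)| ^ p)) := by
    simpa using (tendsto_sum_nat_add τ).const_add (∑' x, |m (g x)| ^ p)
  exact ge_of_tendsto' hlim hub

namespace IsLipDual

variable {X Xs : Type*} [NormedAddCommGroup X] [NormedAddCommGroup Xs] [NormedSpace ℝ Xs]
  {e : Xs →ₗ[ℝ] (X → ℝ)}

theorem abs_sub_le (he : IsLipDual e) (h : Xs) (x y : X) :
    |e h x - e h y| ≤ ‖h‖ * ‖x - y‖ := by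
  simpa [Real.dist_eq, dist_eq_norm] using (he.lip_norm h).dist_le_mul x y

/-- Evaluation at a point, as a bounded functional on the Lipschitz dual. -/
noncomputable def eval (he : IsLipDual e) (x : X) : Xs →L[ℝ] ℝ :=
  LinearMap.mkContinuous ((LinearMap.proj x).comp e) ‖x‖ fun h => by
    simpa [he.map_zero_pt, mul_comm] using he.abs_sub_le h x 0

/-- The bounded functional on the Lipschitz dual induced by a finite combination of points. -/
noncomputable def molecule (he : IsLipDual e) : (X →₀ ℝ) →ₗ[ℝ] Xs →L[ℝ] ℝ :=
  Finsupp.linearCombination ℝ he.eval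

theorem molecule_apply (he : IsLipDual e) (c : X →₀ ℝ) (h : Xs) :
    he.molecule c h = Finsupp.linearCombination ℝ (e h) c := by
  simp [molecule, eval, Finsupp.linearCombination_apply, Finsupp.sum]

theorem eq_zero_of_molecule (he : IsLipDual e) {h : Xs} (H : ∀ c, he.molecule c h = 0) :
    h = 0 := by
  refine he.inj (funext fun x => ?_)
  simpa [molecule_apply] using H (Finsupp.single x 1)

theorem molecule_apply_of_eq (he : IsLipDual e) {V : Type*} [AddCommGroup V] [Module ℝ V]
    {F : X → V} {φ : V →ₗ[ℝ] ℝ} {h : Xs} (H : ∀ x, e h x = φ (F x)) (c : X →₀ ℝ) :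
    he.molecule c h = φ (Finsupp.linearCombination ℝ F c) := by
  simp [molecule_apply, Finsupp.linearCombination_apply, Finsupp.sum, H]

end IsLipDual

/-- Functionals that are close on the normalized increments of `R` have compositions with `R` that
are close in Lipschitz norm. -/
theorem abs_sub_le_of_lipImage {X Z : Type*} [NormedAddCommGroup X] [NormedAddCommGroup Z]
    [NormedSpace ℝ Z] {R : X → Z} {φ φ' : Z →L[ℝ] ℝ} {ε : ℝ}
    (h : ∀ k ∈ lipImage R, |φ k - φ' k| ≤ ε) (x y : X) :
    |(φ (R x) - φ' (R x)) - (φ (R y) - φ' (R y))| ≤ ε * ‖x - y‖ := by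
  rcases eq_or_ne x y with rfl | hxy
  · simp
  have h1 := h _ ⟨x, y, hxy, rfl⟩
  have h0 : 0 < ‖x - y‖ := norm_pos_iff.2 (sub_ne_zero.2 hxy)
  rw [map_smul, map_smul, ← smul_sub, smul_eq_mul, abs_mul, abs_of_nonneg (by positivity),
    inv_mul_le_iff₀ h0, map_sub, map_sub, mul_comm] at h1
  rwa [sub_sub_sub_comm]

/-- Composition with a Lipschitz compact map sends the dual unit ball to a totally bounded
subset of the Lipschitz dual. -/
theorem IsLipCompact.totallyBounded_range {X Xs Z : Type*} [NormedAddCommGroup X]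
    [NormedAddCommGroup Xs] [NormedSpace ℝ Xs] [NormedAddCommGroup Z] [NormedSpace ℝ Z]
    {e : Xs →ₗ[ℝ] (X → ℝ)} (he : IsLipDual e) {R : X → Z} (hR : IsLipCompact R)
    {Φ : { φ : Z →L[ℝ] ℝ // ‖φ‖ ≤ 1 } → Xs} (hΦ : ∀ φ x, e (Φ φ) x = φ.1 (R x)) :
    TotallyBounded (range Φ) := by
  refine totallyBounded_range_of_coordinates fun ε hε => ?_
  have htb : TotallyBounded (lipImage R) := hR.2.totallyBounded.subset subset_closure
  obtain ⟨t, ht, hcov⟩ := Metric.totallyBounded_iff.1 htb (ε / 6) (by positivity)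
  have := ht.fintype
  let k : Fin (Fintype.card t) → Z := fun i => ((Fintype.equivFin t).symm i).1
  refine ⟨_, fun φ i => φ.1 (k i), ?_, ε / 6, by positivity, fun φ φ' hd => ?_⟩
  · refine isBounded_iff_forall_norm_le.2 ⟨∑ i, ‖k i‖, ?_⟩
    rintro _ ⟨φ, rfl⟩
    refine (pi_norm_le_iff_of_nonneg (by positivity)).2 fun i => ?_
    have h1 : ‖k i‖ ≤ ∑ i, ‖k i‖ :=
      Finset.single_le_sum (fun i _ => norm_nonneg (k i)) (Finset.mem_univ i)
    have h2 := φ.1.le_of_opNorm_le φ.2 (k i)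
    rw [one_mul] at h2
    exact h2.trans h1
  have key : ∀ z ∈ lipImage R, |φ.1 z - φ'.1 z| ≤ ε / 2 := fun z hz => by
    obtain ⟨y, hy, hzy⟩ := mem_iUnion₂.1 (hcov hz)
    rw [mem_ball, dist_eq_norm] at hzy
    have h1 := (φ.1.le_of_opNorm_le φ.2 (z - y))
    have h2 := (φ'.1.le_of_opNorm_le φ'.2 (z - y))
    have h3 := (dist_le_pi_dist _ _ (Fintype.equivFin t ⟨y, hy⟩)).trans_lt hd
    simp only [k, Equiv.symm_apply_apply, Real.dist_eq] at h3
    rw [map_sub, Real.norm_eq_abs, one_mul] at h1 h2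
    rw [abs_le] at h1 h2 ⊢
    rw [abs_lt] at h3
    constructor <;> linarith [h1.1, h1.2, h2.1, h2.2, h3.1, h3.2]
  have hle : ‖Φ φ - Φ φ'‖ ≤ ε / 2 := by
    refine he.norm_le _ ⟨ε / 2, by positivity⟩ (LipschitzWith.of_dist_le_mul fun x y => ?_)
    rw [Real.dist_eq, dist_eq_norm, map_sub]
    simp only [Pi.sub_apply, hΦ]
    exact abs_sub_le_of_lipImage key x y
  rw [dist_eq_norm]
  linarith

/-- The Lipschitz transpose of a `p`-summing operator composed with a Lipschitz compact map is
`p`-compact. -/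
theorem IsLipDual.pCompactOp_of_factorization {p : ℝ} (hp : 1 ≤ p) {X Y Xs Z : Type*}
    [NormedAddCommGroup X] [NormedAddCommGroup Y] [NormedSpace ℝ Y]
    [NormedAddCommGroup Xs] [NormedSpace ℝ Xs] [CompleteSpace Xs]
    [NormedAddCommGroup Z] [NormedSpace ℝ Z]
    {e : Xs →ₗ[ℝ] (X → ℝ)} (he : IsLipDual e) {f : X → Y} {ft : (Y →L[ℝ] ℝ) →L[ℝ] Xs}
    (hft : ∀ (ψ : Y →L[ℝ] ℝ) (x : X), e (ft ψ) x = ψ (f x)) {R : X → Z} {U : Z →L[ℝ] Y}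
    (hR : IsLipCompact R) (hU : PSumming p U) (hUR : ∀ x, U (R x) = f x) :
    PCompactOp p ft := by
  have hp0 : 0 < p := by linarith
  have hex : ∀ φ : { φ : Z →L[ℝ] ℝ // ‖φ‖ ≤ 1 }, ∃ h : Xs, ∀ x, e h x = φ.1 (R x) := fun φ => by
    obtain ⟨K, hK⟩ := hR.1.2
    obtain ⟨h, hh⟩ := he.surj (φ.1 ∘ R) (by simp [hR.1.1]) ⟨_, φ.1.lipschitz.comp hK⟩
    exact ⟨h, fun x => by rw [hh]; rfl⟩
  choose Φ hΦ using hex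
  obtain ⟨C, hC, Λ, hΛ0, hΛ1, hΛ⟩ := hU.exists_domination hp0
  obtain ⟨g, hg, hgm⟩ := (hR.totallyBounded_range he hΦ).exists_summable_domination hp0 Λ hΛ0 hΛ1
  have hgC : ∀ n, ‖C • g n‖ ^ p = C ^ p * ‖g n‖ ^ p := fun n => by
    rw [norm_smul, Real.norm_of_nonneg hC, Real.mul_rpow hC (norm_nonneg _)]
  have hCs : Summable fun n => ‖C • g n‖ ^ p := by
    simpa only [hgC] using hg.mul_left (C ^ p)
  refine ⟨fun n => C • g n, hCs, ?_⟩
  rintro _ ⟨ψ, hψ, rfl⟩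
  rw [mem_closedBall_zero_iff] at hψ
  refine exists_hasSum_of_rpow_le_tsum hp he.molecule (fun _ => he.eq_zero_of_molecule) hCs
    fun c => ?_
  set z := Finsupp.linearCombination ℝ R c with hz
  have hUz : U z = Finsupp.linearCombination ℝ f c := by
    simp [hz, Finsupp.linearCombination_apply, Finsupp.sum, hUR]
  let u : boundedFunctions { φ : Z →L[ℝ] ℝ // ‖φ‖ ≤ 1 } :=
    ⟨fun φ => |φ.1 z| ^ p, ‖z‖ ^ p, fun φ => by
      rw [abs_of_nonneg (by positivity)]
      exact Real.rpow_le_rpow (abs_nonneg _) (by simpa using φ.1.le_of_opNorm_le φ.2 z) hp0.le⟩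
  have h1 : |he.molecule c (ft ψ)| ≤ ‖U z‖ := by
    rw [he.molecule_apply_of_eq (φ := ψ.toLinearMap) (hft ψ), hUz]
    simpa using ψ.le_of_opNorm_le hψ _
  calc |he.molecule c (ft ψ)| ^ p ≤ ‖U z‖ ^ p := Real.rpow_le_rpow (abs_nonneg _) h1 hp0.le
    _ ≤ C ^ p * Λ u := hΛ z u fun _ => rfl
    _ ≤ C ^ p * ∑' n, |he.molecule c (g n)| ^ p := by
      refine mul_le_mul_of_nonneg_left (hgm _ u fun φ => ?_) (by positivity)
      rw [he.molecule_apply_of_eq (φ := φ.1.toLinearMap) (hΦ φ)]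
      rfl
    _ = ∑' n, |he.molecule c (C • g n)| ^ p := by
      rw [← tsum_mul_left]
      refine tsum_congr fun n => ?_
      rw [map_smul, smul_eq_mul, abs_mul, abs_of_nonneg hC, Real.mul_rpow hC (abs_nonneg _)]

/-- Every positive summable sequence is negligible against some summable sequence. -/
theorem Summable.exists_tendsto_div_zero {a : ℕ → ℝ} (ha : Summable a) (h0 : ∀ n, 0 < a n) :
    ∃ μ : ℕ → ℝ, (∀ n, 0 < μ n) ∧ Summable μ ∧
      Filter.Tendsto (fun n => a n / μ n) Filter.atTop (nhds 0) := by
  set t : ℕ → ℝ := fun n => ∑' k, a (k + n) with ht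
  have hs : ∀ n, t n = a n + t (n + 1) := fun n => by
    simp only [ht]
    rw [((summable_nat_add_iff n).2 ha).tsum_eq_zero_add, zero_add]
    simp only [add_assoc, add_comm 1 n]
  have ht0 : ∀ n, 0 ≤ t n := fun n => tsum_nonneg fun k => (h0 _).le
  have hlim : Filter.Tendsto (fun n => √(t n)) Filter.atTop (nhds 0) := by
    simpa using (tendsto_sum_nat_add a).sqrt
  have hpos : ∀ n, 0 < √(t n) - √(t (n + 1)) := fun n =>
    sub_pos.2 (Real.sqrt_lt_sqrt (ht0 _) (by linarith [hs n, h0 n]))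
  refine ⟨fun n => √(t n) - √(t (n + 1)), hpos, ?_, ?_⟩
  · refine summable_of_sum_range_le (c := √(t 0)) (fun n => (hpos n).le) fun n => ?_
    rw [Finset.sum_range_sub']
    linarith [Real.sqrt_nonneg (t n)]
  · have h : ∀ n, a n / (√(t n) - √(t (n + 1))) = √(t n) + √(t (n + 1)) := fun n => by
      rw [div_eq_iff (hpos n).ne']
      have h1 := Real.sq_sqrt (ht0 n)
      have h2 := Real.sq_sqrt (ht0 (n + 1))
      nlinarith [hs n]
    simpa only [h, add_zero] using hlim.add ((Filter.tendsto_add_atTop_iff_nat 1).2 hlim)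

/-- A strongly `p`-summable sequence is the product of a `p`-summable scalar sequence and a norm
null sequence. -/
theorem exists_rpow_summable_smul_tendsto_zero {p : ℝ} (hp : 0 < p) {E : Type*}
    [NormedAddCommGroup E] [NormedSpace ℝ E] {g : ℕ → E} (hg : Summable fun n => ‖g n‖ ^ p) :
    ∃ l : ℕ → ℝ, (∀ n, 0 < l n) ∧ (Summable fun n => l n ^ p) ∧
      ∃ h : ℕ → E, (∀ n, g n = l n • h n) ∧
        Filter.Tendsto (fun n => ‖h n‖) Filter.atTop (nhds 0) := by
  have ha : Summable fun n => ‖g n‖ ^ p + (1 / 2) ^ n :=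
    hg.add (summable_geometric_of_lt_one (by norm_num) (by norm_num))
  obtain ⟨μ, hμ, hμs, hlim⟩ := ha.exists_tendsto_div_zero fun n => by positivity
  have hl : ∀ n, 0 < μ n ^ p⁻¹ := fun n => Real.rpow_pos_of_pos (hμ n) _
  have hlp : ∀ n, (μ n ^ p⁻¹) ^ p = μ n := fun n => Real.rpow_inv_rpow (hμ n).le hp.ne'
  refine ⟨fun n => μ n ^ p⁻¹, hl, by simpa only [hlp] using hμs,
    fun n => (μ n ^ p⁻¹)⁻¹ • g n, fun n => (smul_inv_smul₀ (hl n).ne' _).symm, ?_⟩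
  have h1 := hlim.rpow_const (p := p⁻¹) (Or.inr (by positivity))
  rw [Real.zero_rpow (by positivity)] at h1
  refine squeeze_zero (fun _ => norm_nonneg _) (fun n => ?_) h1
  rw [Real.le_rpow_inv_iff_of_pos (norm_nonneg _) (by have := hμ n; positivity) hp, norm_smul,
    norm_inv, Real.norm_of_nonneg (hl n).le, Real.mul_rpow (inv_nonneg.2 (hl n).le) (norm_nonneg _),
    Real.inv_rpow (hl n).le, hlp, inv_mul_eq_div]
  exact div_le_div_of_nonneg_right (by simp) (hμ n).le

/-- An operator dominated by a `p`-summable combination of functionals in the unit ball is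
`p`-summing. -/
theorem PSumming.of_le_tsum {p : ℝ} (hp : 0 < p) {Z Y : Type*} [NormedAddCommGroup Z]
    [NormedSpace ℝ Z] [NormedAddCommGroup Y] [NormedSpace ℝ Y] {U : Z →L[ℝ] Y}
    {φ : ℕ → Z →L[ℝ] ℝ} (hφ : ∀ n, ‖φ n‖ ≤ 1) {l : ℕ → ℝ} (hl : ∀ n, 0 ≤ l n)
    (hs : Summable fun n => l n ^ p) (hU : ∀ z, ‖U z‖ ^ p ≤ ∑' n, l n ^ p * |φ n z| ^ p) :
    PSumming p U := by
  have hle : ∀ (χ : Z →L[ℝ] ℝ), ‖χ‖ ≤ 1 → ∀ z, |χ z| ^ p ≤ ‖z‖ ^ p := fun χ hχ z =>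
    Real.rpow_le_rpow (abs_nonneg _) (by simpa using χ.le_of_opNorm_le hχ z) hp.le
  have hlp : ∀ n, 0 ≤ l n ^ p := fun n => Real.rpow_nonneg (hl n) _
  have hS : 0 ≤ ∑' n, l n ^ p := tsum_nonneg hlp
  have hz : ∀ z, Summable fun n => l n ^ p * |φ n z| ^ p := fun z =>
    Summable.of_nonneg_of_le (fun n => mul_nonneg (hlp n) (by positivity))
      (fun n => mul_le_mul_of_nonneg_left (hle _ (hφ n) z) (hlp n)) (hs.mul_right _)
  refine ⟨(∑' n, l n ^ p) ^ p⁻¹, by positivity, fun N z => ?_⟩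
  rw [Real.rpow_inv_rpow hS hp.ne']
  have hb : BddAbove (range fun χ : { χ : Z →L[ℝ] ℝ // ‖χ‖ ≤ 1 } => ∑ i, |χ.1 (z i)| ^ p) := by
    refine ⟨∑ i, ‖z i‖ ^ p, ?_⟩
    rintro _ ⟨χ, rfl⟩
    exact Finset.sum_le_sum fun i _ => hle _ χ.2 _
  set S := ⨆ χ : { χ : Z →L[ℝ] ℝ // ‖χ‖ ≤ 1 }, ∑ i, |χ.1 (z i)| ^ p with hSdef
  calc ∑ i, ‖U (z i)‖ ^ p ≤ ∑ i, ∑' n, l n ^ p * |φ n (z i)| ^ p :=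
        Finset.sum_le_sum fun i _ => hU _
    _ = ∑' n, ∑ i, l n ^ p * |φ n (z i)| ^ p := (Summable.tsum_finsetSum fun i _ => hz _).symm
    _ ≤ ∑' n, l n ^ p * S := by
      refine Summable.tsum_le_tsum (fun n => ?_) (summable_sum fun i _ => hz _) (hs.mul_right _)
      rw [← Finset.mul_sum]
      exact mul_le_mul_of_nonneg_left (le_ciSup hb ⟨φ n, hφ n⟩) (hlp n)
    _ = (∑' n, l n ^ p) * S := tsum_mul_right

/-- A linear map dominated by a `p`-summable combination of functionals in the unit ball factors
through a `p`-summing operator. -/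
theorem exists_pSumming_extension {p : ℝ} (hp : 0 < p) {V Z Y : Type*} [AddCommGroup V]
    [Module ℝ V] [NormedAddCommGroup Z] [NormedSpace ℝ Z] [NormedAddCommGroup Y]
    [NormedSpace ℝ Y] [CompleteSpace Y] {T : V →ₗ[ℝ] Y} {G : V →ₗ[ℝ] Z} (hG : DenseRange G)
    {φ : ℕ → Z →L[ℝ] ℝ} (hφ : ∀ n, ‖φ n‖ ≤ 1) {l : ℕ → ℝ} (hl : ∀ n, 0 ≤ l n)
    (hs : Summable fun n => l n ^ p) (hT : ∀ v, ‖T v‖ ^ p ≤ ∑' n, l n ^ p * |φ n (G v)| ^ p) :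
    ∃ U : Z →L[ℝ] Y, PSumming p U ∧ ∀ v, U (G v) = T v := by
  have hle : ∀ n z, |φ n z| ≤ ‖z‖ := fun n z => by simpa using (φ n).le_of_opNorm_le (hφ n) z
  have hlp : ∀ n, 0 ≤ l n ^ p := fun n => Real.rpow_nonneg (hl n) _
  have hS : 0 ≤ ∑' n, l n ^ p := tsum_nonneg hlp
  have hterm : ∀ (z : Z) (M : ℝ), ‖z‖ ≤ M → ∀ n, l n ^ p * |φ n z| ^ p ≤ l n ^ p * M ^ p :=
    fun z M hM n => mul_le_mul_of_nonneg_left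
      (Real.rpow_le_rpow (abs_nonneg _) ((hle n z).trans hM) hp.le) (hlp n)
  have hbound : ∀ v, ‖T v‖ ≤ (∑' n, l n ^ p) ^ p⁻¹ * ‖G v‖ := fun v => by
    rw [← Real.rpow_le_rpow_iff (norm_nonneg _) (by positivity) hp,
      Real.mul_rpow (by positivity) (norm_nonneg _), Real.rpow_inv_rpow hS hp.ne']
    refine (hT v).trans ?_
    rw [← tsum_mul_right]
    exact Summable.tsum_le_tsum (hterm _ _ le_rfl)
      (Summable.of_nonneg_of_le (fun n => mul_nonneg (hlp n) (by positivity))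
        (hterm _ _ le_rfl) (hs.mul_right _)) (hs.mul_right _)
  have hUG : ∀ v, T.extendOfNorm G (G v) = T v := LinearMap.extendOfNorm_eq hG ⟨_, hbound⟩
  refine ⟨T.extendOfNorm G, PSumming.of_le_tsum hp hφ hl hs fun z => ?_, hUG⟩
  obtain ⟨u, hu, huz⟩ := mem_closure_iff_seq_limit.1 (hG z)
  choose v hv using hu
  have h1 : Filter.Tendsto (fun k => ‖T.extendOfNorm G (u k)‖ ^ p) Filter.atTop
      (nhds (‖T.extendOfNorm G z‖ ^ p)) :=
    (((T.extendOfNorm G).continuous.tendsto z).comp huz).norm.rpow_const (Or.inr hp.le)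
  have h2 : Filter.Tendsto (fun k => ∑' n, l n ^ p * |φ n (u k)| ^ p) Filter.atTop
      (nhds (∑' n, l n ^ p * |φ n z| ^ p)) := by
    refine tendsto_tsum_of_dominated_convergence (bound := fun n => l n ^ p * (‖z‖ + 1) ^ p)
      (hs.mul_right _) (fun n => ?_) ?_
    · exact ((((φ n).continuous.tendsto z).comp huz).abs.rpow_const (Or.inr hp.le)).const_mul _
    · filter_upwards [huz.norm.eventually_le_const (lt_add_one ‖z‖)] with k hk n
      rw [Real.norm_of_nonneg (mul_nonneg (hlp n) (by positivity))]
      exact hterm _ _ hk n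
  refine le_of_tendsto_of_tendsto' h1 h2 fun k => ?_
  rw [← hv, hUG]
  exact hT _

/-- A map vanishing at zero whose coordinates have Lipschitz constants tending to zero is
Lipschitz compact. -/
theorem isLipCompact_of_coordinates {X Z : Type*} [NormedAddCommGroup X] [NormedAddCommGroup Z]
    [NormedSpace ℝ Z] [CompleteSpace Z] {R : X → Z} (hR0 : R 0 = 0) {φ : ℕ → Z →L[ℝ] ℝ}
    (hnorm : ∀ z M, 0 ≤ M → (∀ n, |φ n z| ≤ M) → ‖z‖ ≤ M) {s : ℕ → ℝ} (hs0 : ∀ n, 0 ≤ s n)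
    (hs : Filter.Tendsto s Filter.atTop (nhds 0))
    (hR : ∀ n x y, |φ n (R x - R y)| ≤ s n * ‖x - y‖) : IsLipCompact R := by
  obtain ⟨K, hK⟩ := hs.bddAbove_range
  have hK : ∀ n, s n ≤ K := fun n => hK (mem_range_self n)
  have hK0 : 0 ≤ K := (hs0 0).trans (hK 0)
  refine ⟨⟨hR0, ⟨K, hK0⟩, LipschitzWith.of_dist_le_mul fun x y => ?_⟩, ?_⟩
  · rw [dist_eq_norm, dist_eq_norm]
    exact hnorm _ _ (by positivity) fun n =>
      (hR n x y).trans (mul_le_mul_of_nonneg_right (hK n) (norm_nonneg _))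
  let D : { q : X × X // q.1 ≠ q.2 } → Z := fun q =>
    ‖q.1.1 - q.1.2‖⁻¹ • (R q.1.1 - R q.1.2)
  have hD : lipImage R = range D := by
    ext z
    constructor
    · rintro ⟨x, y, hxy, rfl⟩
      exact ⟨⟨(x, y), hxy⟩, rfl⟩
    · rintro ⟨q, rfl⟩
      exact ⟨_, _, q.2, rfl⟩
  have hDs : ∀ n q, |φ n (D q)| ≤ s n := fun n q => by
    have h0 : 0 < ‖q.1.1 - q.1.2‖ := norm_pos_iff.2 (sub_ne_zero.2 q.2)
    rw [map_smul, smul_eq_mul, abs_mul, abs_of_nonneg (by positivity), inv_mul_le_iff₀ h0,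
      mul_comm]
    exact hR _ _ _
  suffices h : TotallyBounded (range D) by
    rw [hD]
    exact isCompact_iff_totallyBounded_isComplete.2 ⟨h.closure, isClosed_closure.isComplete⟩
  refine totallyBounded_range_of_coordinates fun ε hε => ?_
  obtain ⟨N, hN⟩ := Filter.eventually_atTop.1
    (hs.eventually_le_const (show 0 < ε / 4 by positivity))
  refine ⟨N, fun q i => φ i (D q), ?_, ε / 2, by positivity, fun q q' hq => ?_⟩
  · refine isBounded_iff_forall_norm_le.2 ⟨K, ?_⟩
    rintro _ ⟨q, rfl⟩
    exact (pi_norm_le_iff_of_nonneg hK0).2 fun i => (hDs _ q).trans (hK _)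
  · rw [dist_eq_norm]
    refine (hnorm _ (ε / 2) (by positivity) fun n => ?_).trans_lt (by linarith)
    rw [map_sub]
    by_cases hn : n < N
    · exact ((dist_le_pi_dist _ _ (⟨n, hn⟩ : Fin N)).trans_lt hq).le
    · have h1 := (hDs n q).trans (hN n (not_lt.1 hn))
      have h2 := (hDs n q').trans (hN n (not_lt.1 hn))
      exact (abs_sub _ _).trans (by linarith)

/-- A map dominated by a weighted sequence of elements of the Lipschitz dual, realized as the
coordinates of a map into a Banach space and tending to zero, factors as a Lipschitz compact map
followed by a `p`-summing operator. -/
theorem IsLipDual.exists_factorization_of_coordinates {p : ℝ} (hp : 0 < p) {X Y Xs F : Type*}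
    [NormedAddCommGroup X] [NormedAddCommGroup Y] [NormedSpace ℝ Y] [CompleteSpace Y]
    [NormedAddCommGroup Xs] [NormedSpace ℝ Xs] [NormedAddCommGroup F] [NormedSpace ℝ F]
    [CompleteSpace F] {e : Xs →ₗ[ℝ] (X → ℝ)} (he : IsLipDual e) {f : X → Y} {l : ℕ → ℝ}
    (hl : ∀ n, 0 ≤ l n) (hs : Summable fun n => l n ^ p) {h : ℕ → Xs}
    (hh : Filter.Tendsto (fun n => ‖h n‖) Filter.atTop (nhds 0))
    (hf : ∀ c, ‖Finsupp.linearCombination ℝ f c‖ ^ p ≤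
      ∑' n, l n ^ p * |he.molecule c (h n)| ^ p)
    {π : ℕ → F →L[ℝ] ℝ} (hπ : ∀ n z, |π n z| ≤ ‖z‖)
    (hnorm : ∀ z M, 0 ≤ M → (∀ n, |π n z| ≤ M) → ‖z‖ ≤ M) {R : X → F}
    (hR : ∀ n x, e (h n) x = π n (R x)) :
    ∃ (Z : Submodule ℝ F) (_ : CompleteSpace Z) (R : X → Z) (U : Z →L[ℝ] Y),
      IsLipCompact R ∧ PSumming p U ∧ ∀ x : X, U (R x) = f x := by
  let G₀ := Finsupp.linearCombination ℝ R
  let Z := (LinearMap.range G₀).topologicalClosure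
  have hZ : ∀ c, G₀ c ∈ Z := fun c =>
    (LinearMap.range G₀).le_topologicalClosure (LinearMap.mem_range_self _ _)
  let G : (X →₀ ℝ) →ₗ[ℝ] Z := G₀.codRestrict Z hZ
  have hG : DenseRange G := fun z => by
    rw [Topology.IsInducing.subtypeVal.closure_eq_preimage_closure_image, mem_preimage,
      ← range_comp]
    exact z.2
  have hZc : CompleteSpace Z := (Submodule.isClosed_topologicalClosure _).completeSpace_coe
  let φ : ℕ → Z →L[ℝ] ℝ := fun n => (π n).comp Z.subtypeL
  have hφ : ∀ n, ‖φ n‖ ≤ 1 := fun n =>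
    ContinuousLinearMap.opNorm_le_bound _ zero_le_one fun z => by
      rw [one_mul]; exact hπ n z.1
  have hφG : ∀ n c, φ n (G c) = he.molecule c (h n) := fun n c =>
    (he.molecule_apply_of_eq (φ := (π n).toLinearMap) (hR n) c).symm
  have hφR : ∀ n x, φ n (G (Finsupp.single x 1)) = e (h n) x := fun n x => by
    rw [hφG, he.molecule_apply]; simp
  obtain ⟨U, hU, hUG⟩ := exists_pSumming_extension hp (T := Finsupp.linearCombination ℝ f) hG hφ
    hl hs fun c => by simpa only [hφG] using hf c
  refine ⟨Z, hZc, fun x => G (Finsupp.single x 1), U, ?_, hU, fun x => by rw [hUG]; simp⟩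
  have hnormZ : ∀ (z : Z) (M : ℝ), 0 ≤ M → (∀ n, |φ n z| ≤ M) → ‖z‖ ≤ M :=
    fun z M hM hz => hnorm z.1 M hM hz
  refine isLipCompact_of_coordinates ?_ hnormZ (fun n => norm_nonneg (h n)) hh fun n x y => ?_
  · refine norm_le_zero_iff.1 (hnormZ _ 0 le_rfl fun n => ?_)
    rw [hφR, he.map_zero_pt, abs_zero]
  · rw [map_sub, hφR, hφR]
    exact he.abs_sub_le _ _ _

/-- A map with `p`-compact Lipschitz transpose factors as a Lipschitz compact map followed by a
`p`-summing operator. -/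
theorem IsLipDual.exists_factorization_of_pCompactOp {p : ℝ} (hp : 1 ≤ p) {X : Type u}
    {Y : Type v} {Xs : Type w} [NormedAddCommGroup X] [NormedAddCommGroup Y] [NormedSpace ℝ Y]
    [CompleteSpace Y] [NormedAddCommGroup Xs] [NormedSpace ℝ Xs]
    {e : Xs →ₗ[ℝ] (X → ℝ)} (he : IsLipDual e) {f : X → Y} {ft : (Y →L[ℝ] ℝ) →L[ℝ] Xs}
    (hft : ∀ (ψ : Y →L[ℝ] ℝ) (x : X), e (ft ψ) x = ψ (f x)) (hc : PCompactOp p ft) :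
    ∃ (Z : Type (max u v)) (_ : NormedAddCommGroup Z) (_ : NormedSpace ℝ Z)
      (_ : CompleteSpace Z) (R : X → Z) (U : Z →L[ℝ] Y),
      IsLipCompact R ∧ PSumming p U ∧ ∀ x : X, U (R x) = f x := by
  have hp0 : 0 < p := by linarith
  obtain ⟨g, hg, hgm⟩ := hc
  obtain ⟨l, hl, hls, h, hgh, hh⟩ := exists_rpow_summable_smul_tendsto_zero hp0 hg
  obtain ⟨K, hK⟩ := hh.bddAbove_range
  have hK : ∀ n, ‖h n‖ ≤ K := fun n => hK (mem_range_self n)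
  let R : X → BoundedContinuousFunction (ULift.{max u v} ℕ) ℝ := fun x =>
    BoundedContinuousFunction.ofNormedAddCommGroupDiscrete (fun n => e (h n.down) x) (K * ‖x‖)
      fun n => by
        have := he.abs_sub_le (h n.down) x 0
        rw [he.map_zero_pt, sub_zero, sub_zero] at this
        exact this.trans (mul_le_mul_of_nonneg_right (hK _) (norm_nonneg _))
  suffices hf : ∀ c, ‖Finsupp.linearCombination ℝ f c‖ ^ p ≤
      ∑' n, l n ^ p * |he.molecule c (h n)| ^ p by
    obtain ⟨Z, hZ, H⟩ := he.exists_factorization_of_coordinates hp0 (fun n => (hl n).le) hls hh hf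
      (π := fun n => BoundedContinuousFunction.evalCLM ℝ (ULift.up n)) (R := R)
      (fun n z => z.norm_coe_le_norm _)
      (fun z M hM hz => (BoundedContinuousFunction.norm_le hM).2 fun n => hz n.down)
      fun n x => rfl
    exact ⟨Z, inferInstance, inferInstance, hZ, H⟩
  intro c
  obtain ⟨ψ, hψ, hψc⟩ := exists_dual_vector'' ℝ (Finsupp.linearCombination ℝ f c)
  obtain ⟨a, ha, has⟩ := hgm _ ⟨ψ, by simpa using hψ, rfl⟩
  have hsum : HasSum (fun n => a n * he.molecule c (g n))
      ‖Finsupp.linearCombination ℝ f c‖ := by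
    have := has.mapL (he.molecule c)
    rw [he.molecule_apply_of_eq (φ := ψ.toLinearMap) (hft ψ)] at this
    simpa [hψc] using this
  have hgp : ∀ n, |he.molecule c (g n)| ^ p = l n ^ p * |he.molecule c (h n)| ^ p := fun n => by
    rw [hgh, map_smul, smul_eq_mul, abs_mul, abs_of_nonneg (hl n).le,
      Real.mul_rpow (hl n).le (abs_nonneg _)]
  have ht : Summable fun n => |he.molecule c (g n)| ^ p := by
    refine Summable.of_nonneg_of_le (fun n => by positivity) (fun n => ?_)
      (hg.mul_left (‖he.molecule c‖ ^ p))
    rw [← Real.mul_rpow (norm_nonneg _) (norm_nonneg _)]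
    exact Real.rpow_le_rpow (abs_nonneg _) ((he.molecule c).le_opNorm _) hp0.le
  obtain ⟨hs, hle⟩ := ha.holder hp ht
  have h1 : ‖Finsupp.linearCombination ℝ f c‖ ≤
      (∑' n, |he.molecule c (g n)| ^ p) ^ (1 / p) := by
    refine le_trans ?_ hle
    rw [← hsum.tsum_eq]
    refine Summable.tsum_le_tsum (fun n => ?_) hsum.summable hs
    rw [← abs_mul]
    exact le_abs_self _
  rw [one_div, Real.le_rpow_inv_iff_of_pos (norm_nonneg _)
    (tsum_nonneg fun n => by positivity) hp0] at h1
  simpa only [hgp] using h1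

theorem stmt_18 (p : ℝ) (hp : 1 ≤ p) {X : Type u} {Y : Type v} {Xs : Type w}
    [NormedAddCommGroup X] [NormedSpace ℝ X]
    [NormedAddCommGroup Y] [NormedSpace ℝ Y] [CompleteSpace Y]
    [NormedAddCommGroup Xs] [NormedSpace ℝ Xs] [CompleteSpace Xs]
    (e : Xs →ₗ[ℝ] (X → ℝ)) (he : IsLipDual e)
    (f : X → Y) (hf : IsLip0 f)
    (ft : (Y →L[ℝ] ℝ) →L[ℝ] Xs)
    (hft : ∀ (ψ : Y →L[ℝ] ℝ) (x : X), e (ft ψ) x = ψ (f x)) :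
    PCompactOp p ft ↔
      ∃ (Z : Type (max u v)) (_ : NormedAddCommGroup Z) (_ : NormedSpace ℝ Z)
        (_ : CompleteSpace Z) (R : X → Z) (U : Z →L[ℝ] Y),
        IsLipCompact R ∧ PSumming p U ∧ ∀ x : X, U (R x) = f x := by
  constructor
  · exact he.exists_factorization_of_pCompactOp hp hft
  · rintro ⟨Z, _, _, _, R, U, hR, hU, hUR⟩
    exact he.pCompactOp_of_factorization hp hft hR hU hUR
end

section
/- Let X and Y be real Banach spaces and let f ∈ Lip₀𝒦(X,Y) be a Lipschitz compact operator. Then there exist a Lipschitz compact map g ∈ Lip₀𝒦(X,c₀) and a Lipschitz map C : g(X) → Y (where g(X) is regarded as a pointed metric subspace of c₀) such that f = C ∘ g. -/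
open scoped NNReal ZeroAtInfty
open Metric Set

open Filter Topology

/-- A countable set in which only finitely many elements exceed any given norm can be
enumerated by a null sequence, after possibly adding `0`. -/
theorem Set.Countable.exists_tendsto_zero {E : Type*} [SeminormedAddCommGroup E] {G : Set E}
    (hG : G.Countable) (hfin : ∀ ε > 0, {x ∈ G | ε ≤ ‖x‖}.Finite) :
    ∃ u : ℕ → E, Tendsto u atTop (𝓝 0) ∧ G ⊆ range u ∧ range u ⊆ insert 0 G := by
  have := hG.to_subtype
  obtain ⟨e, he⟩ := exists_injective_nat G
  refine ⟨Function.extend e Subtype.val 0, ?_, fun x hx => ⟨e ⟨x, hx⟩, he.extend_apply _ _ _⟩, ?_⟩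
  · rw [← Nat.cofinite_eq_atTop, Metric.tendsto_nhds]
    intro ε hε
    rw [eventually_cofinite]
    refine (((hfin ε hε).preimage Subtype.val_injective.injOn).image e).subset fun n hn => ?_
    by_cases h : ∃ a, e a = n
    · obtain ⟨a, rfl⟩ := h
      rw [mem_ofPred_eq, he.extend_apply, dist_zero_right, not_lt] at hn
      exact mem_image_of_mem e ⟨a.2, hn⟩
    · rw [mem_ofPred_eq, Function.extend_apply' _ _ _ h] at hn
      simp [hε] at hn
  · rintro _ ⟨n, rfl⟩
    by_cases h : ∃ a, e a = n
    · obtain ⟨a, rfl⟩ := h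
      rw [he.extend_apply]
      exact Or.inr a.2
    · rw [Function.extend_apply' _ _ _ h]
      exact Or.inl rfl

/-- A form of Grothendieck's theorem on compact sets: a totally bounded set is controlled by a
null sequence of elements of its linear span. -/
theorem TotallyBounded.exists_tendsto_zero_dominating {E : Type*} [SeminormedAddCommGroup E]
    [NormedSpace ℝ E] {M : Set E} (hM : TotallyBounded M) (V : Submodule ℝ E) (hMV : M ⊆ V) :
    ∃ u : ℕ → E, Tendsto u atTop (𝓝 0) ∧ (∀ n, u n ∈ V) ∧
      ∀ x ∈ M, ∀ (l : E →L[ℝ] ℝ) (r : ℝ), (∀ n, |l (u n)| ≤ r) → |l x| ≤ 3 * r := by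
  choose N hNM hNfin hMN using fun i : ℕ =>
    finite_approx_of_totallyBounded hM ((1 / 4 : ℝ) ^ i) (by positivity)
  let D : ℕ → Set E := fun i =>
    {z ∈ image2 (fun a b => (2 : ℝ) ^ i • (a - b)) (N (i + 1)) (N i) | ‖z‖ ≤ 2 * (1 / 2) ^ i}
  have hD : ∀ i, (D i).Finite := fun i => ((hNfin _).image2 _ (hNfin _)).subset (sep_subset _ _)
  obtain ⟨u, hu, hGu, huG⟩ := Set.Countable.exists_tendsto_zero (G := N 0 ∪ ⋃ i, D i)
    ((hNfin 0).countable.union (countable_iUnion fun i => (hD i).countable)) (by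
      intro ε hε
      obtain ⟨n, hn⟩ := exists_pow_lt_of_lt_one (half_pos hε) (by norm_num : (1 / 2 : ℝ) < 1)
      refine ((hNfin 0).union ((finite_lt_nat n).biUnion fun i _ => hD i)).subset ?_
      rintro x ⟨hx | hx, hxε⟩
      · exact Or.inl hx
      · obtain ⟨i, hi⟩ := mem_iUnion.1 hx
        refine Or.inr (mem_biUnion (?_ : i < n) hi)
        by_contra! hin
        have := pow_le_pow_of_le_one (by norm_num : (0 : ℝ) ≤ 1 / 2) (by norm_num) hin
        linarith [hi.2])
  refine ⟨u, hu, fun n => ?_, fun x hx l r hr => ?_⟩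
  · rcases huG ⟨n, rfl⟩ with h | h | h
    · rw [h]
      exact V.zero_mem
    · exact hMV (hNM 0 h)
    · obtain ⟨i, ⟨a, ha, b, hb, hab⟩, -⟩ := mem_iUnion.1 h
      rw [← hab]
      exact V.smul_mem _ (V.sub_mem (hMV (hNM _ ha)) (hMV (hNM _ hb)))
  · have hlG : ∀ z ∈ N 0 ∪ ⋃ i, D i, |l z| ≤ r := by
      intro z hz
      obtain ⟨n, rfl⟩ := hGu hz
      exact hr n
    have hr0 : 0 ≤ r := (abs_nonneg _).trans (hr 0)
    have hex : ∀ i, ∃ y ∈ N i, dist x y < (1 / 4 : ℝ) ^ i := fun i => by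
      simpa using hMN i hx
    choose y hyN hxy using hex
    have hbound : ∀ n, |l (y n)| ≤ (3 - 2 * (1 / 2) ^ n) * r := by
      intro n
      induction n with
      | zero =>
        have := hlG _ (Or.inl (hyN 0))
        norm_num
        exact this
      | succ n ih =>
        have hp : (0 : ℝ) < 2 ^ n := by positivity
        have hpp : (2 : ℝ) ^ n * (1 / 2) ^ n = 1 := by rw [← mul_pow]; norm_num
        have h4 : (1 / 4 : ℝ) ^ n = (1 / 2) ^ n * (1 / 2) ^ n := by rw [← mul_pow]; norm_num
        have hyy : ‖y (n + 1) - y n‖ ≤ 2 * (1 / 4) ^ n := by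
          have h1 := dist_triangle_left (y (n + 1)) (y n) x
          have h2 : (1 / 4 : ℝ) ^ (n + 1) ≤ (1 / 4) ^ n :=
            pow_le_pow_of_le_one (by norm_num) (by norm_num) n.le_succ
          rw [← dist_eq_norm]
          linarith [hxy n, hxy (n + 1)]
        have hmem : (2 : ℝ) ^ n • (y (n + 1) - y n) ∈ D n := by
          refine ⟨mem_image2_of_mem (hyN _) (hyN _), ?_⟩
          rw [norm_smul, Real.norm_of_nonneg hp.le]
          calc (2 : ℝ) ^ n * ‖y (n + 1) - y n‖ ≤ 2 ^ n * (2 * (1 / 4) ^ n) := by gcongr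
            _ = 2 * (1 / 2) ^ n * (2 ^ n * (1 / 2) ^ n) := by rw [h4]; ring
            _ = 2 * (1 / 2) ^ n := by rw [hpp, mul_one]
        have hl := hlG _ (Or.inr (mem_iUnion.2 ⟨n, hmem⟩))
        rw [map_smul, smul_eq_mul, abs_mul, abs_of_pos hp, map_sub] at hl
        have hl' : |l (y (n + 1)) - l (y n)| ≤ (1 / 2) ^ n * r := by
          calc _ = (1 / 2 : ℝ) ^ n * (2 ^ n * |l (y (n + 1)) - l (y n)|) := by
                rw [← mul_assoc, mul_comm ((1 / 2 : ℝ) ^ n), hpp, one_mul]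
            _ ≤ _ := by gcongr
        have := abs_sub_abs_le_abs_sub (l (y (n + 1))) (l (y n))
        rw [pow_succ]
        linarith
    have hlim : Tendsto y atTop (𝓝 x) := by
      rw [tendsto_iff_dist_tendsto_zero]
      refine squeeze_zero (fun _ => dist_nonneg) (fun i => ?_)
        (tendsto_pow_atTop_nhds_zero_of_lt_one (by norm_num : (0 : ℝ) ≤ 1 / 4) (by norm_num))
      rw [dist_comm]
      exact (hxy i).le
    refine le_of_tendsto ((l.continuous.tendsto x).comp hlim).abs (Eventually.of_forall fun n => ?_)
    refine (hbound n).trans (mul_le_mul_of_nonneg_right ?_ hr0)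
    have : (0 : ℝ) < (1 / 2) ^ n := by positivity
    linarith

/-- Restriction of continuous functionals to a compact set, as a linear map. -/
noncomputable def dualRestrict {Y : Type*} [NormedAddCommGroup Y] [NormedSpace ℝ Y] (K : Set Y)
    [CompactSpace K] : StrongDual ℝ Y →ₗ[ℝ] BoundedContinuousFunction K ℝ where
  toFun φ := .mkOfCompact ⟨fun k => φ k, φ.continuous.comp continuous_subtype_val⟩
  map_add' _ _ := rfl
  map_smul' _ _ := rfl

theorem totallyBounded_dualRestrict_image {Y : Type*} [NormedAddCommGroup Y] [NormedSpace ℝ Y]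
    (K : Set Y) [CompactSpace K] :
    TotallyBounded (dualRestrict K '' closedBall 0 1) := by
  obtain ⟨R, hR⟩ := (isCompact_iff_compactSpace.2 ‹_›).isBounded.exists_norm_le
  refine (BoundedContinuousFunction.arzela_ascoli (closedBall (0 : ℝ) R) (isCompact_closedBall 0 R)
    _ ?_ ?_).totallyBounded.subset subset_closure
  · rintro _ k ⟨φ, hφ, rfl⟩
    rw [mem_closedBall_zero_iff] at hφ ⊢
    exact (φ.le_of_opNorm_le hφ k).trans (by simpa using hR k k.2)
  · refine equicontinuous_of_continuity_modulus id tendsto_id _ ?_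
    rintro x y ⟨_, φ, hφ, rfl⟩
    rw [mem_closedBall_zero_iff] at hφ
    change dist (φ x) (φ y) ≤ dist x y
    rw [dist_eq_norm, ← map_sub, Subtype.dist_eq, dist_eq_norm]
    simpa using φ.le_of_opNorm_le hφ (x - y : Y)

/-- On a compact set the norm is dominated by a sequence of functionals converging to zero
uniformly on that set. -/
theorem IsCompact.exists_dual_seq {Y : Type*} [NormedAddCommGroup Y] [NormedSpace ℝ Y]
    {K : Set Y} (hK : IsCompact K) :
    ∃ (φ : ℕ → StrongDual ℝ Y) (b : ℕ → ℝ), Tendsto b atTop (𝓝 0) ∧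
      (∀ n, ∀ k ∈ K, |φ n k| ≤ b n) ∧
      ∀ k ∈ K, ∀ r, (∀ n, |φ n k| ≤ r) → ‖k‖ ≤ 3 * r := by
  have := isCompact_iff_compactSpace.1 hK
  obtain ⟨u, hu, huV, hdom⟩ := (totallyBounded_dualRestrict_image K).exists_tendsto_zero_dominating
    (LinearMap.range (dualRestrict K)) (image_subset_range _ _)
  choose φ hφ using huV
  have hval : ∀ n (k : K), u n k = φ n k := fun n k => by
    rw [← hφ n]
    rfl
  refine ⟨φ, fun n => ‖u n‖, tendsto_zero_iff_norm_tendsto_zero.1 hu, fun n k hk => ?_,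
    fun k hk r hr => ?_⟩
  · rw [← hval n ⟨k, hk⟩]
    exact (u n).norm_coe_le_norm _
  · obtain ⟨ψ, hψ, hψk⟩ := exists_dual_vector'' ℝ k
    have := hdom (dualRestrict K ψ) (mem_image_of_mem _ (mem_closedBall_zero_iff.2 hψ))
      (BoundedContinuousFunction.evalCLM ℝ ⟨k, hk⟩) r (fun n => by
        change |u n ⟨k, hk⟩| ≤ r
        rw [hval]
        exact hr n)
    change |ψ k| ≤ 3 * r at this
    rw [hψk] at this
    exact (le_abs_self _).trans this

namespace ZeroAtInftyContinuousMap

/-- The element of `c₀` given by a null sequence. -/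
def ofTendsto (z : ℕ → ℝ) (hz : Tendsto z atTop (𝓝 0)) : C₀(ℕ, ℝ) where
  toFun := z
  continuous_toFun := continuous_of_discreteTopology
  zero_at_infty' := by rwa [cocompact_eq_cofinite, Nat.cofinite_eq_atTop]

@[simp]
theorem ofTendsto_apply (z : ℕ → ℝ) (hz : Tendsto z atTop (𝓝 0)) (n : ℕ) :
    ofTendsto z hz n = z n := rfl

theorem norm_le_iff {z : C₀(ℕ, ℝ)} {r : ℝ} (hr : 0 ≤ r) : ‖z‖ ≤ r ↔ ∀ n, |z n| ≤ r := by
  rw [← norm_toBCF_eq_norm, BoundedContinuousFunction.norm_le hr]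
  rfl

/-- A sequence of continuous functions tending to zero uniformly defines a continuous map
into `c₀`. -/
theorem continuous_of_uniform_bound {T : Type*} [TopologicalSpace T] {F : T → C₀(ℕ, ℝ)}
    {b : ℕ → ℝ} (hb : Tendsto b atTop (𝓝 0)) (hFb : ∀ t n, |F t n| ≤ b n)
    (hF : ∀ n, Continuous fun t => F t n) : Continuous F := by
  refine continuous_iff_continuousAt.2 fun t => Metric.tendsto_nhds.2 fun ε hε => ?_
  obtain ⟨N, hN⟩ := eventually_atTop.1 (hb.eventually (gt_mem_nhds (by positivity : 0 < ε / 4)))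
  have hev : ∀ᶠ s in 𝓝 t, ∀ n < N, dist (F s n) (F t n) < ε / 2 :=
    (eventually_all_finite (finite_lt_nat N)).2 fun n _ =>
      Metric.tendsto_nhds.1 (hF n).continuousAt _ (half_pos hε)
  filter_upwards [hev] with s hs
  rw [dist_eq_norm]
  refine lt_of_le_of_lt ((norm_le_iff (half_pos hε).le).2 fun n => ?_) (half_lt_self hε)
  rw [coe_sub, Pi.sub_apply]
  rcases lt_or_ge n N with h | h
  · exact (hs n h).le
  · have := abs_sub (F s n) (F t n)
    linarith [hFb s n, hFb t n, hN n h]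

end ZeroAtInftyContinuousMap

theorem stmt_19 {X Y : Type*} [NormedAddCommGroup X] [NormedSpace ℝ X] [CompleteSpace X]
    [NormedAddCommGroup Y] [NormedSpace ℝ Y] [CompleteSpace Y]
    (f : X → Y) (hf : IsLipCompact f) :
    ∃ g : X → C₀(ℕ, ℝ), IsLipCompact g ∧
      ∃ (L : ℝ≥0) (C : Set.range g → Y), LipschitzWith L C ∧
        ∀ x : X, C ⟨g x, Set.mem_range_self x⟩ = f x := by
  obtain ⟨⟨hf0, -⟩, hK⟩ := hf
  obtain ⟨φ, b, hb, hφb, hdom⟩ := hK.exists_dual_seq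
  have hincr : ∀ x y, x ≠ y → ‖x - y‖⁻¹ • (f x - f y) ∈ closure (lipImage f) :=
    fun x y h => subset_closure ⟨x, y, h, rfl⟩
  have hpos : ∀ {x y : X}, x ≠ y → 0 < ‖x - y‖ := fun h => norm_pos_iff.2 (sub_ne_zero.2 h)
  have hscale : ∀ n x y, φ n (‖x - y‖⁻¹ • (f x - f y)) =
      ‖x - y‖⁻¹ * (φ n (f x) - φ n (f y)) := fun n x y => by
    rw [map_smul, map_sub, smul_eq_mul]
  have hle : ∀ n x y, |φ n (f x) - φ n (f y)| ≤ b n * ‖x - y‖ := by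
    intro n x y
    rcases eq_or_ne x y with rfl | h
    · simp
    · have := hφb n _ (hincr x y h)
      rwa [hscale n x y, abs_mul, abs_of_pos (inv_pos.2 (hpos h)), inv_mul_le_iff₀ (hpos h),
        mul_comm] at this
  have hnull : ∀ x, Tendsto (fun n => φ n (f x)) atTop (𝓝 0) := fun x =>
    squeeze_zero_norm (fun n => by simpa [hf0] using hle n x 0)
      (by simpa using hb.mul_const ‖x‖)
  let g : X → C₀(ℕ, ℝ) := fun x => .ofTendsto _ (hnull x)
  have hg : ∀ x n, g x n = φ n (f x) := fun _ _ => rfl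
  have hgsub : ∀ x y n, (g x - g y) n = φ n (f x) - φ n (f y) := fun _ _ _ => rfl
  have hg_lip : ∃ L : ℝ≥0, LipschitzWith L g := by
    obtain ⟨B, hB⟩ := hb.bddAbove_range
    refine ⟨B.toNNReal, LipschitzWith.of_dist_le_mul fun x y => ?_⟩
    rw [dist_eq_norm, dist_eq_norm, ZeroAtInftyContinuousMap.norm_le_iff (by positivity)]
    intro n
    refine (hle n x y).trans (mul_le_mul_of_nonneg_right ?_ (norm_nonneg _))
    exact (hB ⟨n, rfl⟩).trans (Real.le_coe_toNNReal B)
  have hg_compact : IsCompact (closure (lipImage g)) := by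
    have := isCompact_iff_compactSpace.1 hK
    have hKnull : ∀ k : closure (lipImage f), Tendsto (fun n => φ n k) atTop (𝓝 0) := fun k =>
      squeeze_zero_norm (fun n => hφb n k k.2) hb
    let F : closure (lipImage f) → C₀(ℕ, ℝ) := fun k => .ofTendsto _ (hKnull k)
    have hF : Continuous F := ZeroAtInftyContinuousMap.continuous_of_uniform_bound hb
      (fun k n => hφb n k k.2) fun n => (φ n).continuous.comp continuous_subtype_val
    refine (isCompact_range hF).closure_of_subset ?_
    rintro _ ⟨x, y, h, rfl⟩
    refine ⟨⟨_, hincr x y h⟩, ?_⟩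
    ext n
    exact hscale n x y
  have hfg : ∀ x y, dist (f x) (f y) ≤ 3 * dist (g x) (g y) := by
    intro x y
    rcases eq_or_ne x y with rfl | h
    · simp
    · have := hdom _ (hincr x y h) (‖x - y‖⁻¹ * ‖g x - g y‖) fun n => by
        rw [hscale n x y, abs_mul, abs_of_pos (inv_pos.2 (hpos h)), ← hgsub]
        gcongr
        exact (ZeroAtInftyContinuousMap.norm_le_iff (norm_nonneg _)).1 le_rfl n
      rw [norm_smul, norm_inv, norm_norm, mul_left_comm] at this
      rw [dist_eq_norm, dist_eq_norm]
      exact le_of_mul_le_mul_left this (inv_pos.2 (hpos h))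
  refine ⟨g, ⟨⟨?_, hg_lip⟩, hg_compact⟩, 3, fun z => f z.2.choose,
    LipschitzWith.of_dist_le_mul fun z w => ?_, fun x => ?_⟩
  · ext n
    simp [hg, hf0]
  · have := hfg z.2.choose w.2.choose
    rwa [z.2.choose_spec, w.2.choose_spec] at this
  · have := hfg (mem_range_self (f := g) x).choose x
    rw [(mem_range_self (f := g) x).choose_spec, dist_self, mul_zero] at this
    exact dist_le_zero.1 this
end
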